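/- Let D be an integral domain that is not a field, with quotient field Q, such that fPD(D) = ∞. Then R = D(+)(Q/D) is a total ring of quotients (every non-zero-divisor of R is a unit) with fPD(R) = ∞. -/

import Mathlib

open CategoryTheory

universe u

/-- `M` has a projective resolution `0 → P_n → ⋯ → P_0 → M → 0` of length at most `n`
(the `P_i` projective, not necessarily finitely generated). -/
def HasProjResLE (R : Type u) [CommRing R] :
    ℕ → ∀ (M : Type u) [AddCommGroup M] [Module R M], Prop
  | 0, M, _, _ => Module.Projective R M
  | n + 1, M, _, _ => ∃ (P : Type u) (_ : AddCommGroup P) (_ : Module R P) (f : P →ₗ[R] M),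
      Module.Projective R P ∧ Function.Surjective f ∧ HasProjResLE R n (LinearMap.ker f)

/-- `M` has a finite projective resolution `0 → P_n → ⋯ → P_0 → M → 0` of length `n`
with each `P_i` finitely generated projective. -/
def HasFPRLen (R : Type u) [CommRing R] :
    ℕ → ∀ (M : Type u) [AddCommGroup M] [Module R M], Prop
  | 0, M, _, _ => Module.Finite R M ∧ Module.Projective R M
  | n + 1, M, _, _ => ∃ (P : Type u) (_ : AddCommGroup P) (_ : Module R P) (f : P →ₗ[R] M),
      Module.Finite R P ∧ Module.Projective R P ∧ Function.Surjective f ∧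
        HasFPRLen R n (LinearMap.ker f)

/-- `M` has a finite projective resolution by finitely generated projectives. -/
def HasFPR (R : Type u) [CommRing R] (M : Type u) [AddCommGroup M] [Module R M] : Prop :=
  ∃ n, HasFPRLen R n M

/-- The projective dimension of `M`, as an element of `ℕ∞` (with `⊤` meaning no finite
projective resolution exists). -/
noncomputable def projDim (R : Type u) [CommRing R] (M : Type u) [AddCommGroup M]
    [Module R M] : ℕ∞ :=
  sInf {n : ℕ∞ | ∃ m : ℕ, n = m ∧ HasProjResLE R m M}

/-- The small finitistic dimension `fPD R`: the supremum, in `ℕ∞`, of the projective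
dimensions of `R`-modules having a finite projective resolution. -/
noncomputable def fPD (R : Type u) [CommRing R] : ℕ∞ :=
  ⨆ (M : ModuleCat.{u} R) (_ : HasFPR R M), projDim R M

/-- For a module over a commutative ring, the canonical right module structure. -/
noncomputable local instance moduleOpOfModule (R : Type u) [CommRing R] (M : Type u)
    [AddCommGroup M] [Module R M] : Module Rᵐᵒᵖ M :=
  Module.compHom M ((RingHom.id R).fromOpposite mul_comm)

local instance isCentralScalarOfModule (R : Type u) [CommRing R] (M : Type u)
    [AddCommGroup M] [Module R M] : IsCentralScalar R M :=
  ⟨fun _ _ => rfl⟩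

open TensorProduct

theorem hasProjResLE_iff_hasProjectiveDimensionLE {R : Type u} [CommRing R] (n : ℕ)
    (M : Type u) [AddCommGroup M] [Module R M] :
    HasProjResLE R n M ↔ HasProjectiveDimensionLE (ModuleCat.of R M) n := by
  induction n generalizing M with
  | zero =>
    rw [← projective_iff_hasProjectiveDimensionLE_zero, ← IsProjective.iff_projective]
    rfl
  | succ n ih =>
    constructor
    · rintro ⟨P, _, _, f, hP, hf, hk⟩
      have hP' : Projective (ModuleCat.of R P) := (IsProjective.iff_projective P).1 hP
      exact ((LinearMap.shortExact_shortComplexKer hf).hasProjectiveDimensionLT_X₃_iff n hP').2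
        ((ih _).1 hk)
    · intro h
      have hf : Function.Surjective (Finsupp.linearCombination R (id : M → M)) :=
        Finsupp.linearCombination_id_surjective R M
      have hP' : Projective (ModuleCat.of R (M →₀ R)) :=
        (IsProjective.iff_projective _).1 inferInstance
      exact ⟨M →₀ R, _, _, _, inferInstance, hf, (ih _).2
        (((LinearMap.shortExact_shortComplexKer hf).hasProjectiveDimensionLT_X₃_iff n hP').1 h)⟩

theorem HasProjResLE.ker {R : Type u} [CommRing R] {n : ℕ} {M P : Type u} [AddCommGroup M]
    [Module R M] [AddCommGroup P] [Module R P] [Module.Projective R P]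
    (h : HasProjResLE R (n + 1) M) {f : P →ₗ[R] M} (hf : Function.Surjective f) :
    HasProjResLE R n (LinearMap.ker f) := by
  have hP' : Projective (ModuleCat.of R P) := (IsProjective.iff_projective P).1 inferInstance
  rw [hasProjResLE_iff_hasProjectiveDimensionLE] at h ⊢
  exact ((LinearMap.shortExact_shortComplexKer hf).hasProjectiveDimensionLT_X₃_iff n hP').1 h

theorem HasProjResLE.of_equiv {R : Type u} [CommRing R] {n : ℕ} {M N : Type u} [AddCommGroup M]
    [Module R M] [AddCommGroup N] [Module R N] (e : M ≃ₗ[R] N) (h : HasProjResLE R n M) :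
    HasProjResLE R n N := by
  cases n with
  | zero =>
    have : Module.Projective R M := h
    exact Module.Projective.of_equiv e
  | succ n =>
    obtain ⟨P, _, _, f, hP, hf, hk⟩ := h
    refine ⟨P, _, _, e.toLinearMap ∘ₗ f, hP, e.surjective.comp hf, ?_⟩
    rwa [LinearEquiv.ker_comp]

theorem HasFPRLen.of_equiv {R : Type u} [CommRing R] {n : ℕ} {M N : Type u} [AddCommGroup M]
    [Module R M] [AddCommGroup N] [Module R N] (e : M ≃ₗ[R] N) (h : HasFPRLen R n M) :
    HasFPRLen R n N := by
  cases n with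
  | zero =>
    obtain ⟨_, _⟩ := h
    exact ⟨Module.Finite.equiv e, Module.Projective.of_equiv e⟩
  | succ n =>
    obtain ⟨P, _, _, f, hfin, hP, hf, hk⟩ := h
    refine ⟨P, _, _, e.toLinearMap ∘ₗ f, hfin, hP, e.surjective.comp hf, ?_⟩
    rwa [LinearEquiv.ker_comp]

theorem projDim_le_of_hasProjResLE {R : Type u} [CommRing R] {n : ℕ} {M : Type u}
    [AddCommGroup M] [Module R M] (h : HasProjResLE R n M) : projDim R M ≤ n :=
  sInf_le ⟨n, rfl, h⟩

theorem exists_hasProjResLE_of_projDim_le {R : Type u} [CommRing R] {n : ℕ} {M : Type u}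
    [AddCommGroup M] [Module R M] (h : projDim R M ≤ n) : ∃ m ≤ n, HasProjResLE R m M := by
  have hlt : projDim R M < ((n + 1 : ℕ) : ℕ∞) := h.trans_lt (by exact_mod_cast n.lt_succ_self)
  obtain ⟨_, ⟨m, rfl, hm⟩, hmn⟩ := sInf_lt_iff.1 hlt
  exact ⟨m, Nat.lt_succ_iff.1 (by exact_mod_cast hmn), hm⟩

/-- `A` is `Tor₁`-independent of all torsion-free `D`-modules: tensoring with `A` preserves
the injectivity of the kernel inclusion of every surjection onto a torsion-free module. -/
def PreservesTorsionFreeKernels (D : Type u) [CommRing D] (A : Type u) [AddCommGroup A]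
    [Module D A] : Prop :=
  ∀ ⦃P M : Type u⦄ [AddCommGroup P] [AddCommGroup M] [Module D P] [Module D M]
    [Module.IsTorsionFree D M] (f : P →ₗ[D] M), Function.Surjective f →
    Function.Injective ((LinearMap.ker f).subtype.lTensor A)

section BaseChange

variable {D : Type u} [CommRing D] {R : Type u} [CommRing R] [Algebra D R]

/-- Base change commutes with the kernel of a surjection onto a torsion-free module. -/
noncomputable def PreservesTorsionFreeKernels.kerBaseChangeEquiv
    (hR : PreservesTorsionFreeKernels D R) {P M : Type u} [AddCommGroup P] [AddCommGroup M]
    [Module D P] [Module D M] [Module.IsTorsionFree D M] (f : P →ₗ[D] M)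
    (hf : Function.Surjective f) :
    R ⊗[D] LinearMap.ker f ≃ₗ[R] LinearMap.ker (f.baseChange R) :=
  have hinj : Function.Injective ((LinearMap.ker f).subtype.baseChange R) := hR f hf
  have hex : LinearMap.range ((LinearMap.ker f).subtype.baseChange R) =
      LinearMap.ker (f.baseChange R) := by
    ext x
    exact (lTensor_exact R (LinearMap.exact_subtype_ker_map f) hf x).symm
  (LinearEquiv.ofInjective _ hinj).trans (LinearEquiv.ofEq _ _ hex)

theorem HasFPRLen.baseChange [IsDomain D] (hR : PreservesTorsionFreeKernels D R) {n : ℕ}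
    {M : Type u} [AddCommGroup M] [Module D M] [Module.IsTorsionFree D M]
    (h : HasFPRLen D n M) : HasFPRLen R n (R ⊗[D] M) := by
  induction n generalizing M with
  | zero =>
    obtain ⟨_, _⟩ := h
    exact ⟨inferInstance, inferInstance⟩
  | succ n ih =>
    obtain ⟨P, _, _, f, _, _, hf, hk⟩ := h
    exact ⟨R ⊗[D] P, _, _, f.baseChange R, inferInstance, inferInstance,
      f.lTensor_surjective R hf, (ih hk).of_equiv (hR.kerBaseChangeEquiv f hf)⟩

theorem Module.Projective.of_baseChange_of_retraction [Algebra R D] [IsScalarTower D R D]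
    (M : Type u) [AddCommGroup M] [Module D M] [Module.Projective R (R ⊗[D] M)] :
    Module.Projective D M :=
  Module.Projective.of_equiv
    ((AlgebraTensorModule.cancelBaseChange D R D D M).trans (TensorProduct.lid D M))

theorem HasProjResLE.of_baseChange [IsDomain D] [Algebra R D] [IsScalarTower D R D]
    (hR : PreservesTorsionFreeKernels D R) {n : ℕ} {M : Type u} [AddCommGroup M] [Module D M]
    [Module.IsTorsionFree D M] (h : HasProjResLE R n (R ⊗[D] M)) : HasProjResLE D n M := by
  induction n generalizing M with
  | zero =>
    have : Module.Projective R (R ⊗[D] M) := h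
    exact Module.Projective.of_baseChange_of_retraction (R := R) M
  | succ n ih =>
    have hf : Function.Surjective (Finsupp.linearCombination D (id : M → M)) :=
      Finsupp.linearCombination_id_surjective D M
    refine ⟨M →₀ D, _, _, _, inferInstance, hf, ih ?_⟩
    have hf' : Function.Surjective ((Finsupp.linearCombination D (id : M → M)).baseChange R) :=
      LinearMap.lTensor_surjective R hf
    exact (h.ker hf').of_equiv (hR.kerBaseChangeEquiv _ hf).symm

theorem fPD_le_add_one_of_retraction [IsDomain D] [Algebra R D] [IsScalarTower D R D]
    (hR : PreservesTorsionFreeKernels D R) {N : ℕ} (hN : fPD R ≤ N) :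
    fPD D ≤ (N + 1 : ℕ) := by
  refine iSup₂_le fun M hM => ?_
  obtain ⟨n, hn⟩ := hM
  cases n with
  | zero =>
    have h0 : HasProjResLE D 0 M := hn.2
    exact (projDim_le_of_hasProjResLE h0).trans (by exact_mod_cast Nat.zero_le _)
  | succ n =>
    obtain ⟨P, _, _, f, _, _, hf, hk⟩ := hn
    have hle : projDim R (R ⊗[D] LinearMap.ker f) ≤ N :=
      (le_iSup₂_of_le (f := fun (L : ModuleCat.{u} R) (_ : HasFPR R L) => projDim R L)
        (ModuleCat.of R (R ⊗[D] LinearMap.ker f)) ⟨n, hk.baseChange hR⟩ le_rfl).trans hN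
    obtain ⟨m, hmN, hm⟩ := exists_hasProjResLE_of_projDim_le hle
    have hM : HasProjResLE D (m + 1) M :=
      ⟨P, _, _, f, inferInstance, hf, HasProjResLE.of_baseChange hR hm⟩
    exact (projDim_le_of_hasProjResLE hM).trans (by exact_mod_cast Nat.succ_le_succ hmN)

end BaseChange

section FractionQuotient

variable (D : Type u) [CommRing D] [IsDomain D]

theorem preservesTorsionFreeKernels_fractionRing_quotient :
    PreservesTorsionFreeKernels D
      ((FractionRing D) ⧸ LinearMap.range (Algebra.linearMap D (FractionRing D))) := by
  intro P M _ _ _ _ _ f hf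
  set Q := FractionRing D
  set I := LinearMap.range (Algebra.linearMap D Q)
  set K := LinearMap.ker f
  have exact_mkQ (N : Type u) [AddCommGroup N] [Module D N] :
      Function.Exact ((Algebra.linearMap D Q).rTensor N) (I.mkQ.rTensor N) :=
    rTensor_exact N (LinearMap.exact_map_mkQ_range _) I.mkQ_surjective
  rw [injective_iff_map_eq_zero]
  intro x hx
  obtain ⟨y, rfl⟩ := I.mkQ.rTensor_surjective K I.mkQ_surjective x
  have hy : I.mkQ.rTensor P (K.subtype.lTensor Q y) = 0 := by
    rw [← hx, ← LinearMap.comp_apply, ← LinearMap.comp_apply, LinearMap.rTensor_comp_lTensor,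
      LinearMap.lTensor_comp_rTensor]
  obtain ⟨t, ht⟩ := (exact_mkQ P _).1 hy
  obtain ⟨p, rfl⟩ := (TensorProduct.lid D P).symm.surjective t
  have hp : (1 : Q) ⊗ₜ[D] p = K.subtype.lTensor Q y := by simpa using ht
  have hfp : (1 : Q) ⊗ₜ[D] f p = 0 := by
    have := congrArg (f.lTensor Q) hp
    rw [LinearMap.lTensor_tmul, ← LinearMap.comp_apply, ← LinearMap.lTensor_comp] at this
    rw [LinearMap.comp_ker_subtype, LinearMap.lTensor_zero, LinearMap.zero_apply] at this
    exact this
  obtain ⟨c, hc⟩ := (IsLocalizedModule.eq_zero_iff (nonZeroDivisors D)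
    (TensorProduct.mk D Q M 1)).1 hfp
  have hpK : p ∈ K := by
    have hc0 : (c : D) ≠ 0 := nonZeroDivisors.coe_ne_zero c
    exact (smul_eq_zero_iff_right hc0).1 hc
  have hyp : y = (1 : Q) ⊗ₜ[D] (⟨p, hpK⟩ : K) := by
    apply Module.Flat.lTensor_preserves_injective_linearMap (M := Q) K.subtype K.subtype_injective
    rw [← hp]
    simp
  rw [hyp, exact_mkQ K]
  exact ⟨1 ⊗ₜ ⟨p, hpK⟩, by simp⟩

theorem exists_smul_eq_zero_of_not_isUnit (hD : ¬ IsField D) {d : D} (hd : ¬ IsUnit d) :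
    ∃ m : (FractionRing D) ⧸ LinearMap.range (Algebra.linearMap D (FractionRing D)),
      m ≠ 0 ∧ d • m = 0 := by
  obtain ⟨a, ha0, ha, hda⟩ : ∃ a : D, a ≠ 0 ∧ ¬ IsUnit a ∧ a ∣ d := by
    rcases eq_or_ne d 0 with rfl | h
    · obtain ⟨a, ha0, ha⟩ := Ring.exists_not_isUnit_of_not_isField hD
      exact ⟨a, ha0, ha, dvd_zero a⟩
    · exact ⟨d, h, hd, dvd_rfl⟩
  have ha' : algebraMap D (FractionRing D) a ≠ 0 := by simpa using ha0
  refine ⟨Submodule.Quotient.mk (algebraMap D (FractionRing D) a)⁻¹, ?_, ?_⟩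
  · rw [Ne, Submodule.Quotient.mk_eq_zero]
    rintro ⟨b, hb⟩
    refine ha (IsUnit.of_mul_eq_one b ?_)
    apply IsFractionRing.injective D (FractionRing D)
    rw [Algebra.linearMap_apply] at hb
    rw [map_mul, hb, mul_inv_cancel₀ ha', map_one]
  · obtain ⟨c, rfl⟩ := hda
    rw [← Submodule.Quotient.mk_smul, Submodule.Quotient.mk_eq_zero]
    refine ⟨c, ?_⟩
    rw [Algebra.linearMap_apply, Algebra.smul_def, map_mul]
    field_simp

end FractionQuotient

theorem PreservesTorsionFreeKernels.trivSqZeroExt {D : Type u} [CommRing D] {N : Type u}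
    [AddCommGroup N] [Module D N] (hN : PreservesTorsionFreeKernels D N) :
    PreservesTorsionFreeKernels D (TrivSqZeroExt D N) := by
  intro P M _ _ _ _ _ f hf
  rw [injective_iff_map_eq_zero]
  intro x hx
  have key {A : Type u} [AddCommGroup A] [Module D A] (g : TrivSqZeroExt D N →ₗ[D] A)
      (hA : Function.Injective ((LinearMap.ker f).subtype.lTensor A)) :
      g.rTensor (LinearMap.ker f) x = 0 := by
    apply hA
    rw [map_zero, ← LinearMap.comp_apply, LinearMap.lTensor_comp_rTensor,
      ← LinearMap.rTensor_comp_lTensor, LinearMap.comp_apply, hx, map_zero]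
  have hfst := key (TrivSqZeroExt.fstHom D D N).toLinearMap
    (Module.Flat.lTensor_preserves_injective_linearMap _ (LinearMap.ker f).subtype_injective)
  have hsnd := key (TrivSqZeroExt.sndHom D N) (hN f hf)
  have hsplit : (TrivSqZeroExt.inlAlgHom D D N).toLinearMap ∘ₗ
        (TrivSqZeroExt.fstHom D D N).toLinearMap +
      TrivSqZeroExt.inrHom D N ∘ₗ TrivSqZeroExt.sndHom D N = LinearMap.id := by
    ext y <;> simp
  rw [← LinearMap.id_apply (R := D) x, ← LinearMap.rTensor_id, ← hsplit, LinearMap.rTensor_add,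
    LinearMap.rTensor_comp, LinearMap.rTensor_comp, LinearMap.add_apply, LinearMap.comp_apply,
    LinearMap.comp_apply, hfst, hsnd, map_zero, map_zero, add_zero]

theorem TrivSqZeroExt.isUnit_of_mem_nonZeroDivisors {D : Type u} [CommRing D] {N : Type u}
    [AddCommGroup N] [Module D N] (hN : ∀ d : D, ¬ IsUnit d → ∃ m : N, m ≠ 0 ∧ d • m = 0)
    {x : TrivSqZeroExt D N} (hx : x ∈ nonZeroDivisors (TrivSqZeroExt D N)) : IsUnit x := by
  rw [TrivSqZeroExt.isUnit_iff_isUnit_fst]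
  by_contra hu
  obtain ⟨m, hm0, hm⟩ := hN _ hu
  refine hm0 (TrivSqZeroExt.inr_injective (R := D) ?_)
  rw [TrivSqZeroExt.inr_zero]
  refine hx.1 _ ?_
  ext
  · simp
  · simpa using hm

/-- If `D` is a non-field domain with `fPD D = ∞`, then `R = D(+)(Q/D)` is a total ring of
quotients with `fPD R = ∞`. -/
theorem trivSqZeroExt_totalRingOfQuotients_fPD_top (D : Type u) [CommRing D] [IsDomain D]
    (hD : ¬ IsField D) (hfPD : fPD D = ⊤) :
    (∀ x : TrivSqZeroExt D ((FractionRing D) ⧸ LinearMap.range (Algebra.linearMap D (FractionRing D))),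
        x ∈ nonZeroDivisors (TrivSqZeroExt D ((FractionRing D) ⧸ LinearMap.range (Algebra.linearMap D (FractionRing D)))) → IsUnit x) ∧
      fPD (TrivSqZeroExt D ((FractionRing D) ⧸ LinearMap.range (Algebra.linearMap D (FractionRing D)))) = ⊤ := by
  refine ⟨fun x hx => ?_, ?_⟩
  · convert TrivSqZeroExt.isUnit_of_mem_nonZeroDivisors
      (fun _ hd => exists_smul_eq_zero_of_not_isUnit D hD hd) hx using 3
    · rfl
    · rfl
    · ext r m
      induction m using Submodule.Quotient.induction_on with | H q
      refine congrArg (Submodule.Quotient.mk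
        (p := LinearMap.range (Algebra.linearMap D (FractionRing D)))) ?_
      exact op_smul_eq_smul r.unop q
  · let _ := TrivSqZeroExt.algebraBase D
      ((FractionRing D) ⧸ LinearMap.range (Algebra.linearMap D (FractionRing D)))
    by_contra hR
    obtain ⟨N, hN⟩ := ENat.ne_top_iff_exists.1 hR
    have := fPD_le_add_one_of_retraction
      (preservesTorsionFreeKernels_fractionRing_quotient D).trivSqZeroExt hN.ge
    rw [hfPD, top_le_iff] at this
    exact ENat.natCast_ne_top _ this
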